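/- Under Assumption 1, if θ := P(S₊ⁱ = 0) > 0, P(S₊ⁱ < ∞) = 1, and equality E(Sᵗ) = E(Sⁱ) holds (where E(Sᵗ) := Σ_{k=1}^∞ k·π_k), then there exists k ∈ ℕ such that P(Sⁱ = k) = 1, i.e., the inspected cluster size is almost surely constant. -/

import Mathlib

open MeasureTheory Filter Set ENNReal

noncomputable section

/-- The cluster `C(ω) = {t : I_t(ω) = 1}` of a binary process. -/
def clusterSet {Ω : Type*} (I : ℤ → Ω → Bool) (ω : Ω) : Set ℤ :=
  {t : ℤ | I t ω = true}

/-- Inspected cluster size `Sⁱ(ω) = Σ_{t ∈ ℤ} I_t(ω) ∈ ℕ ∪ {∞}`. -/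
def SiFn {Ω : Type*} (I : ℤ → Ω → Bool) (ω : Ω) : ℕ∞ :=
  {t : ℤ | I t ω = true}.encard

/-- Forward inspected cluster size `S₊ⁱ(ω) = Σ_{t ≥ 1} I_t(ω) ∈ ℕ₀ ∪ {∞}`. -/
def SplusFn {Ω : Type*} (I : ℤ → Ω → Bool) (ω : Ω) : ℕ∞ :=
  {t : ℤ | 0 < t ∧ I t ω = true}.encard

/-- Backward inspected cluster size `S₋ⁱ(ω) = Σ_{t ≤ -1} I_t(ω) ∈ ℕ₀ ∪ {∞}`. -/
def SminusFn {Ω : Type*} (I : ℤ → Ω → Bool) (ω : Ω) : ℕ∞ :=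
  {t : ℤ | t < 0 ∧ I t ω = true}.encard

lemma aux_cyl {Ω : Type*} [MeasurableSpace Ω] (P : Measure Ω) [IsProbabilityMeasure P]
    (I : ℤ → Ω → Bool)
    {Ωn : ℕ → Type*} [∀ n, MeasurableSpace (Ωn n)]
    (Pn : ∀ n, Measure (Ωn n))
    (In : ∀ n, ℤ → Ωn n → Bool)
    (hstat : ∀ n (F : Finset ℤ) (ε : ℤ → Bool) (k : ℤ),
      Pn n {ω | ∀ t ∈ F, In n t ω = ε t} = Pn n {ω | ∀ t ∈ F, In n (t + k) ω = ε t})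
    (hconv : ∀ (F : Finset ℤ) (ε : ℤ → Bool),
      Tendsto (fun n =>
          Pn n ({ω | ∀ t ∈ F, In n t ω = ε t} ∩ {ω | In n 0 ω = true})
            / Pn n {ω | In n 0 ω = true}) atTop
        (nhds (P {ω | ∀ t ∈ F, I t ω = ε t})))
    (s : ℤ) (G : Finset ℤ) (ε : ℤ → Bool) (h0 : 0 ∈ G) (hs : s ∈ G)
    (e0 : ε 0 = true) (es : ε s = true) :
    P {ω | ∀ t ∈ G, I t ω = ε t} = P {ω | ∀ t ∈ G, I (t - s) ω = ε t} := by
  have h1 := hconv G ε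
  have h2 := hconv (G.image (fun t => t - s)) (fun u => ε (u + s))
  have e2 : {ω | ∀ t ∈ G.image (fun t => t - s), I t ω = ε (t + s)}
      = {ω | ∀ t ∈ G, I (t - s) ω = ε t} := by
    ext ω; simp
  rw [e2] at h2
  refine tendsto_nhds_unique h1 (h2.congr fun n => ?_)
  congr 1
  have e3 : {ω | ∀ t ∈ G, In n t ω = ε t} ∩ {ω | In n 0 ω = true}
      = {ω | ∀ t ∈ G, In n t ω = ε t} := by
    apply inter_eq_left.2
    intro ω hω
    simpa [e0] using hω 0 h0
  rw [e3, hstat n G ε (-s)]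
  congr 1
  ext ω
  simp only [Finset.mem_image, mem_inter_iff, mem_ofPred_eq, forall_exists_index, and_imp,
    forall_apply_eq_imp_iff₂, sub_add_cancel, ← sub_eq_add_neg]
  constructor
  · exact fun h => h.1
  · refine fun h => ⟨h, ?_⟩
    simpa [es] using h s hs

lemma aux_zero {Ω : Type*} [MeasurableSpace Ω] (P : Measure Ω) [IsProbabilityMeasure P]
    (I : ℤ → Ω → Bool) (hI : ∀ t, Measurable (I t))
    {Ωn : ℕ → Type*} [∀ n, MeasurableSpace (Ωn n)]
    (Pn : ∀ n, Measure (Ωn n)) (hPn : ∀ n, IsProbabilityMeasure (Pn n))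
    (In : ∀ n, ℤ → Ωn n → Bool)
    (hpos : ∀ n, 0 < Pn n {ω | In n 0 ω = true})
    (hconv : ∀ (F : Finset ℤ) (ε : ℤ → Bool),
      Tendsto (fun n =>
          Pn n ({ω | ∀ t ∈ F, In n t ω = ε t} ∩ {ω | In n 0 ω = true})
            / Pn n {ω | In n 0 ω = true}) atTop
        (nhds (P {ω | ∀ t ∈ F, I t ω = ε t}))) :
    ∀ᵐ ω ∂P, I 0 ω = true := by
  have h := hconv {0} (fun _ => true)
  simp only [Finset.mem_singleton, forall_eq, inter_self] at h
  have h1 : ∀ n, Pn n {ω | In n 0 ω = true} / Pn n {ω | In n 0 ω = true} = 1 := fun n =>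
    ENNReal.div_self (hpos n).ne' (measure_ne_top _ _)
  simp only [h1] at h
  have h2 := tendsto_nhds_unique h tendsto_const_nhds
  have hm : MeasurableSet {ω | I 0 ω = true} := hI 0 (measurableSet_singleton true)
  exact (mem_ae_iff_prob_eq_one hm).2 h2

lemma aux_meas {Ω : Type*} [MeasurableSpace Ω] (P : Measure Ω) [IsProbabilityMeasure P]
    (I : ℤ → Ω → Bool) (hI : ∀ t, Measurable (I t)) (h0 : ∀ᵐ ω ∂P, I 0 ω = true) (s : ℤ)
    (hcyl : ∀ (G : Finset ℤ) (ε : ℤ → Bool), 0 ∈ G → s ∈ G → ε 0 = true → ε s = true →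
      P {ω | ∀ t ∈ G, I t ω = ε t} = P {ω | ∀ t ∈ G, I (t - s) ω = ε t}) :
    (P.restrict {ω | I s ω = true}).map (fun ω t => I t ω)
      = (P.restrict {ω | I (-s) ω = true}).map (fun ω t => I (t - s) ω) := by
  have m1 : Measurable (fun ω t => I t ω) := measurable_pi_lambda _ hI
  have m2 : Measurable (fun ω (t : ℤ) => I (t - s) ω) := measurable_pi_lambda _ (fun t => hI _)
  have ms : ∀ s, MeasurableSet {ω | I s ω = true} := fun s => hI s (measurableSet_singleton true)
  refine IsProjectiveLimit.unique (P := fun J => ((P.restrict {ω | I s ω = true}).map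
    (fun ω t => I t ω)).map J.restrict) (fun J => rfl) (fun J => ?_)
  refine Measure.ext_of_singleton fun e => ?_
  have mJ : Measurable (J.restrict : (ℤ → Bool) → _) := Finset.measurable_restrict J
  rw [Measure.map_apply mJ (measurableSet_singleton _), Measure.map_apply mJ (measurableSet_singleton _),
    Measure.map_apply m2 (mJ (measurableSet_singleton _)),
    Measure.map_apply m1 (mJ (measurableSet_singleton _)),
    Measure.restrict_apply' (ms _), Measure.restrict_apply' (ms _)]
  have a1 : ∀ A : Set Ω, P A = P (A ∩ {ω | I 0 ω = true}) := by
    intro A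
    refine measure_congr ?_
    filter_upwards [h0] with ω hω
    apply propext
    exact ⟨fun h => ⟨h, hω⟩, fun h => h.1⟩
  rw [a1, a1 (_ ∩ {ω | I s ω = true})]
  by_cases hc : ∀ t : J, (t : ℤ) = 0 ∨ (t : ℤ) = s → e t = true
  · have := hcyl (insert 0 (insert s J)) (fun t => if t = 0 ∨ t = s then true else
      if h : t ∈ J then e ⟨t, h⟩ else true) (by simp) (by simp) (by simp) (by simp)
    convert this.symm using 2
    · ext ω
      simp only [mem_inter_iff, mem_preimage, mem_singleton_iff, mem_ofPred_eq, funext_iff,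
        Finset.restrict, Subtype.forall, Finset.mem_insert]
      constructor
      · rintro ⟨⟨h1, h2⟩, h3⟩ t ht
        split_ifs with h4 h5
        · rcases h4 with rfl | rfl
          · simpa using h2
          · simpa using h3
        · exact h1 t h5
        · tauto
      · intro h
        refine ⟨⟨fun t ht => ?_, by simpa using h 0⟩, by simpa using h s⟩
        rw [h t (by tauto)]
        split_ifs with h4
        · exact (hc ⟨t, ht⟩ h4).symm
        · rfl
    · ext ω
      simp only [mem_inter_iff, mem_preimage, mem_singleton_iff, mem_ofPred_eq, funext_iff,
        Finset.restrict, Subtype.forall, Finset.mem_insert]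
      constructor
      · rintro ⟨⟨h1, h2⟩, h3⟩ t ht
        split_ifs with h4 h5
        · rcases h4 with rfl | rfl
          · simpa using h3
          · simpa using h2
        · exact h1 t h5
        · tauto
      · intro h
        refine ⟨⟨fun t ht => ?_, by simpa using h s⟩, by simpa using h 0⟩
        rw [h t (by tauto)]
        split_ifs with h4
        · exact (hc ⟨t, ht⟩ h4).symm
        · rfl
  · push Not at hc
    obtain ⟨⟨t, htJ⟩, ht, hne⟩ := hc
    rw [show ((fun ω (t : ℤ) => I (t - s) ω) ⁻¹' (J.restrict ⁻¹' {e}) ∩ {ω | I (-s) ω = true})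
      ∩ {ω | I 0 ω = true} = ∅ from ?_, show ((fun ω (t : ℤ) => I t ω) ⁻¹' (J.restrict ⁻¹' {e}) ∩ {ω | I s ω = true})
      ∩ {ω | I 0 ω = true} = ∅ from ?_]
    · rw [eq_empty_iff_forall_notMem]
      rintro ω ⟨⟨h1, h2⟩, h3⟩
      have h1' := congrFun (show J.restrict (fun t => I t ω) = e from h1) ⟨t, htJ⟩
      simp only [Finset.restrict, mem_ofPred_eq] at h1' h2 h3 ht
      rcases ht with rfl | rfl
      · exact hne (h1'.symm.trans h3)
      · exact hne (h1'.symm.trans h2)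
    · rw [eq_empty_iff_forall_notMem]
      rintro ω ⟨⟨h1, h2⟩, h3⟩
      have h1' := congrFun (show J.restrict (fun t => I (t-s) ω) = e from h1) ⟨t, htJ⟩
      simp only [Finset.restrict, mem_ofPred_eq] at h1' h2 h3 ht
      rcases ht with rfl | rfl
      · rw [zero_sub] at h1'
        exact hne (h1'.symm.trans h2)
      · rw [sub_self] at h1'
        exact hne (h1'.symm.trans h3)

/-- size of a path, as an extended nonnegative real -/
def pathSize (x : ℤ → Bool) : ℝ≥0∞ := ∑' t, if x t = true then 1 else 0

lemma pathSize_meas : Measurable pathSize := by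
  unfold pathSize
  refine Measurable.tsum fun t => ?_
  have hm : MeasurableSet {x : ℤ → Bool | x t = true} :=
    (measurable_pi_apply (X := fun _ : ℤ => Bool) t) (measurableSet_singleton true)
  exact Measurable.ite hm measurable_const measurable_const

lemma pathSize_shift (x : ℤ → Bool) (s : ℤ) : pathSize (fun t => x (t - s)) = pathSize x := by
  unfold pathSize
  exact (Equiv.subRight s).tsum_eq (fun t => if x t = true then (1 : ℝ≥0∞) else 0)

lemma pathSize_eq {Ω : Type*} (I : ℤ → Ω → Bool) (ω : Ω) :
    (SiFn I ω : ℝ≥0∞) = pathSize (fun t => I t ω) := by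
  unfold SiFn pathSize
  rw [← ENNReal.tsum_set_one, tsum_subtype {t : ℤ | I t ω = true} (fun _ => (1 : ℝ≥0∞))]
  refine tsum_congr fun t => ?_
  simp [indicator]

lemma aux_mtp {Ω : Type*} [MeasurableSpace Ω] (P : Measure Ω)
    (I : ℤ → Ω → Bool) (hI : ∀ t, Measurable (I t))
    (htr : ∀ s, (P.restrict {ω | I s ω = true}).map (fun ω t => I t ω)
      = (P.restrict {ω | I (-s) ω = true}).map (fun ω t => I (t - s) ω))
    (B : Set (ℤ → Bool)) (hB : MeasurableSet B) (H : ℝ≥0∞ → ℝ≥0∞) (hH : Measurable H) :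
    ∫⁻ ω, H (SiFn I ω) * ∑' s, (if I s ω = true then B.indicator 1 (fun t => I (t + s) ω) else 0) ∂P
      = ∫⁻ ω, H (SiFn I ω) * (B.indicator 1 (fun t => I t ω) * (SiFn I ω)) ∂P := by
  have m1 : Measurable (fun ω t => I t ω) := measurable_pi_lambda _ hI
  have m2 : ∀ s : ℤ, Measurable (fun ω (t : ℤ) => I (t - s) ω) :=
    fun s => measurable_pi_lambda _ (fun t => hI _)
  have m3 : ∀ s : ℤ, Measurable (fun ω (t : ℤ) => I (t + s) ω) :=
    fun s => measurable_pi_lambda _ (fun t => hI _)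
  have m4 : ∀ s : ℤ, Measurable (fun (x : ℤ → Bool) (t : ℤ) => x (t + s)) :=
    fun s => measurable_pi_lambda _ (fun t => measurable_pi_apply _)
  have ms : ∀ s, MeasurableSet {ω | I s ω = true} := fun s => hI s (measurableSet_singleton true)
  have mB : Measurable (B.indicator (1 : (ℤ → Bool) → ℝ≥0∞)) := measurable_one.indicator hB
  have mS := pathSize_meas
  simp only [pathSize_eq]
  have key : ∀ s : ℤ, ∫⁻ ω, {ω | I s ω = true}.indicator (fun ω => H (pathSize (fun t => I t ω)) *
        B.indicator 1 (fun t => I (t + s) ω)) ω ∂P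
      = ∫⁻ ω, {ω | I (-s) ω = true}.indicator (fun ω => H (pathSize (fun t => I t ω)) *
        B.indicator 1 (fun t => I t ω)) ω ∂P := by
    intro s
    rw [lintegral_indicator (ms _), lintegral_indicator (ms _)]
    have mf : Measurable (fun x : ℤ → Bool => H (pathSize x) * B.indicator 1 (fun t => x (t + s))) :=
      (hH.comp mS).mul (mB.comp (m4 s))
    have h1 := lintegral_map (μ := P.restrict {ω | I s ω = true}) mf m1
    have h2 := lintegral_map (μ := P.restrict {ω | I (-s) ω = true}) mf (m2 s)
    rw [htr s, h2] at h1
    rw [← h1]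
    refine lintegral_congr fun ω => ?_
    rw [pathSize_shift (fun t => I t ω) s]
    simp
  calc _ = ∫⁻ ω, ∑' s, {ω | I s ω = true}.indicator (fun ω => H (pathSize (fun t => I t ω)) *
        B.indicator 1 (fun t => I (t + s) ω)) ω ∂P := by
        refine lintegral_congr fun ω => ?_
        rw [← ENNReal.tsum_mul_left]
        refine tsum_congr fun s => ?_
        simp [indicator]
    _ = ∑' s, ∫⁻ ω, {ω | I s ω = true}.indicator (fun ω => H (pathSize (fun t => I t ω)) *
        B.indicator 1 (fun t => I (t + s) ω)) ω ∂P := by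
        refine lintegral_tsum fun s => (Measurable.indicator ?_ (ms s)).aemeasurable
        exact ((hH.comp (mS.comp m1))).mul (mB.comp (m3 s))
    _ = ∑' s : ℤ, ∫⁻ ω, {ω | I (-s) ω = true}.indicator (fun ω => H (pathSize (fun t => I t ω)) *
        B.indicator 1 (fun t => I t ω)) ω ∂P := tsum_congr key
    _ = ∑' s : ℤ, ∫⁻ ω, {ω | I s ω = true}.indicator (fun ω => H (pathSize (fun t => I t ω)) *
        B.indicator 1 (fun t => I t ω)) ω ∂P := (Equiv.neg ℤ).tsum_eq (fun s : ℤ => ∫⁻ ω, {ω | I s ω = true}.indicator (fun ω => H (pathSize (fun t => I t ω)) *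
        B.indicator 1 (fun t => I t ω)) ω ∂P)
    _ = ∫⁻ ω, ∑' s, {ω | I s ω = true}.indicator (fun ω => H (pathSize (fun t => I t ω)) *
        B.indicator 1 (fun t => I t ω)) ω ∂P := by
        symm
        refine lintegral_tsum fun s => (Measurable.indicator ?_ (ms s)).aemeasurable
        exact ((hH.comp (mS.comp m1))).mul (mB.comp m1)
    _ = _ := by
        refine lintegral_congr fun ω => ?_
        rw [← mul_assoc]
        refine Eq.trans ?_ (ENNReal.tsum_mul_left (f := fun s => if I s ω = true then 1 else 0))
        refine tsum_congr fun s => ?_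
        simp [indicator]

lemma sum_max (x : ℤ → Bool) (h0 : x 0 = true) (hb : {t : ℤ | 0 < t ∧ x t = true}.Finite) :
    ∑' s, (if x s = true then
      {y : ℤ → Bool | ∀ t > 0, y t = false}.indicator (1 : (ℤ → Bool) → ℝ≥0∞) (fun t => x (t + s))
      else 0) = 1 := by
  obtain ⟨b, hb⟩ := hb.bddAbove
  obtain ⟨m, hm, hmax⟩ := Int.exists_greatest_of_bdd (P := fun t => x t = true)
    ⟨max b 0, fun z hz => by
      by_cases h : 0 < z
      · exact le_max_of_le_left (hb ⟨h, hz⟩)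
      · exact le_max_of_le_right (not_lt.1 h)⟩ ⟨0, h0⟩
  rw [tsum_eq_single m]
  · rw [if_pos hm, indicator_of_mem]
    · rfl
    · intro t ht
      by_contra hc
      have := hmax (t + m) (by simpa using hc)
      omega
  · intro s hs
    split_ifs with h
    · apply indicator_of_notMem
      intro hmem
      have hlt : s < m := lt_of_le_of_ne (hmax s h) hs
      have := hmem (m - s) (by omega)
      simp [hm] at this
    · rfl

lemma sum_min (x : ℤ → Bool) (h0 : x 0 = true) (hb : {t : ℤ | x t = true}.Finite) :
    ∑' s, (if x s = true then
      {y : ℤ → Bool | ∀ t < 0, y t = false}.indicator (1 : (ℤ → Bool) → ℝ≥0∞) (fun t => x (t + s))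
      else 0) = 1 := by
  obtain ⟨b, hb⟩ := hb.bddBelow
  obtain ⟨m, hm, hmin⟩ := Int.exists_least_of_bdd (P := fun t => x t = true)
    ⟨b, fun z hz => hb hz⟩ ⟨0, h0⟩
  rw [tsum_eq_single m]
  · rw [if_pos hm, indicator_of_mem]
    · rfl
    · intro t ht
      by_contra hc
      have := hmin (t + m) (by simpa using hc)
      omega
  · intro s hs
    split_ifs with h
    · apply indicator_of_notMem
      intro hmem
      have hlt : m < s := lt_of_le_of_ne (hmin s h) hs.symm
      have := hmem (m - s) (by omega)
      simp [hm] at this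
    · rfl

lemma meas_false (p : ℤ → Prop) :
    MeasurableSet {y : ℤ → Bool | ∀ t, p t → y t = false} := by
  have : {y : ℤ → Bool | ∀ t, p t → y t = false} =
      ⋂ t, ⋂ (_ : p t), (fun y : ℤ → Bool => y t) ⁻¹' {false} := by
    ext y; simp
  rw [this]
  exact MeasurableSet.iInter fun t => MeasurableSet.iInter fun _ =>
    measurable_pi_apply (X := fun _ : ℤ => Bool) t (measurableSet_singleton false)

/-- equality case of the Jensen inequality used at the end -/
lemma jensen_pt (k : ℕ) (hk : 1 ≤ k) (m : ℝ) (hm : 0 < m) :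
    ENNReal.ofReal (2 * m) ≤ (k : ℝ≥0∞) + ENNReal.ofReal (m ^ 2) * (k : ℝ≥0∞)⁻¹ ∧
    (ENNReal.ofReal (2 * m) = (k : ℝ≥0∞) + ENNReal.ofReal (m ^ 2) * (k : ℝ≥0∞)⁻¹ → (k : ℝ) = m) := by
  have hk' : (0 : ℝ) < k := by exact_mod_cast hk
  have e : (k : ℝ≥0∞) + ENNReal.ofReal (m ^ 2) * (k : ℝ≥0∞)⁻¹
      = ENNReal.ofReal (k + m ^ 2 * (k : ℝ)⁻¹) := by
    rw [ENNReal.ofReal_add (by positivity) (by positivity), ENNReal.ofReal_mul (by positivity),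
      ENNReal.ofReal_inv_of_pos hk', ENNReal.ofReal_natCast]
  have e2 : (k : ℝ) + m ^ 2 * (k : ℝ)⁻¹ - 2 * m = (k - m) ^ 2 / k := by
    field_simp
    ring
  rw [e]
  constructor
  · apply ENNReal.ofReal_le_ofReal
    have : 0 ≤ ((k : ℝ) - m) ^ 2 / k := by positivity
    linarith
  · intro h
    rw [ENNReal.ofReal_eq_ofReal_iff (by positivity) (by positivity)] at h
    have : ((k : ℝ) - m) ^ 2 / k = 0 := by linarith
    rw [_root_.div_eq_zero_iff] at this
    rcases this with h | h
    · have := pow_eq_zero_iff (two_ne_zero) |>.1 h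
      linarith
    · exact absurd h hk'.ne'

/-- Theorem 4.2(b), final part: under Assumption 1, if `θ = P(S₊ⁱ = 0) > 0`,
`P(S₊ⁱ < ∞) = 1` and `E(Sᵗ) = E(Sⁱ)`, then the inspected cluster size is a.s.
constant: `P(Sⁱ = k) = 1` for some `k ∈ ℕ`. -/
theorem equality_implies_constant_cluster_size
    {Ω : Type*} [MeasurableSpace Ω] (P : Measure Ω) [IsProbabilityMeasure P]
    (I : ℤ → Ω → Bool) (hI : ∀ t, Measurable (I t))
    {Ωn : ℕ → Type*} [∀ n, MeasurableSpace (Ωn n)]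
    (Pn : ∀ n, Measure (Ωn n)) (hPn : ∀ n, IsProbabilityMeasure (Pn n))
    (In : ∀ n, ℤ → Ωn n → Bool) (hIn : ∀ n t, Measurable (In n t))
    -- `P(I₀ⁿ = 1) > 0` for all `n`
    (hpos : ∀ n, 0 < Pn n {ω | In n 0 ω = true})
    -- stationarity of each `(Iₜⁿ)ₜ`
    (hstat : ∀ n (F : Finset ℤ) (ε : ℤ → Bool) (k : ℤ),
      Pn n {ω | ∀ t ∈ F, In n t ω = ε t} = Pn n {ω | ∀ t ∈ F, In n (t + k) ω = ε t})
    -- convergence of the conditional finite-dimensional distributions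
    (hconv : ∀ (F : Finset ℤ) (ε : ℤ → Bool),
      Tendsto (fun n =>
          Pn n ({ω | ∀ t ∈ F, In n t ω = ε t} ∩ {ω | In n 0 ω = true})
            / Pn n {ω | In n 0 ω = true}) atTop
        (nhds (P {ω | ∀ t ∈ F, I t ω = ε t})))

    (hθ : 0 < P {ω | SplusFn I ω = 0}) (hfin : P {ω | SplusFn I ω ≠ ⊤} = 1)
    (heq : (∑' k : ℕ, (k : ℝ≥0∞) * (P ({ω | SiFn I ω = ((k : ℕ) : ℕ∞)} ∩ {ω | SminusFn I ω = 0}) / P {ω | SminusFn I ω = 0})) = ∫⁻ ω, (SiFn I ω : ℝ≥0∞) ∂P) :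
    ∃ k : ℕ, 1 ≤ k ∧ P {ω | SiFn I ω = (k : ℕ∞)} = 1 := by
  have h0 := aux_zero P I hI Pn hPn In hpos hconv
  have htr := fun s => aux_meas P I hI h0 s
    (fun G ε a b c d => aux_cyl P I Pn In hstat hconv s G ε a b c d)
  have m1 : Measurable (fun ω t => I t ω) := measurable_pi_lambda _ hI
  have mS : Measurable (fun ω => (SiFn I ω : ℝ≥0∞)) := by
    simp only [pathSize_eq]
    exact pathSize_meas.comp m1
  have mSi : Measurable (fun ω => (SiFn I ω : ℝ≥0∞)⁻¹) := mS.inv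
  have mk : ∀ k : ℕ∞, MeasurableSet {ω | SiFn I ω = k} := by
    intro k
    have : {ω | SiFn I ω = k} = (fun ω => (SiFn I ω : ℝ≥0∞)) ⁻¹' {(k : ℝ≥0∞)} := by
      ext ω; simp
    rw [this]
    exact mS (measurableSet_singleton _)
  have hBp := meas_false (fun t => t > 0)
  have hBm := meas_false (fun t => t < 0)
  have mIm : Measurable (fun ω => {y : ℤ → Bool | ∀ t < 0, y t = false}.indicator
      (1 : (ℤ → Bool) → ℝ≥0∞) (fun t => I t ω)) := (measurable_one.indicator hBm).comp m1
  have mIp : Measurable (fun ω => {y : ℤ → Bool | ∀ t > 0, y t = false}.indicator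
      (1 : (ℤ → Bool) → ℝ≥0∞) (fun t => I t ω)) := (measurable_one.indicator hBp).comp m1
  have emn : ∀ ω, SminusFn I ω = 0 ↔ (fun t => I t ω) ∈ {y : ℤ → Bool | ∀ t < 0, y t = false} := by
    intro ω
    simp [SminusFn, Set.eq_empty_iff_forall_notMem]
  have mm : MeasurableSet {ω | SminusFn I ω = 0} := by
    simp only [emn]
    exact m1 hBm
  have hI' : ∀ ω, {y : ℤ → Bool | ∀ t < 0, y t = false}.indicator
      (1 : (ℤ → Bool) → ℝ≥0∞) (fun t => I t ω) = {ω | SminusFn I ω = 0}.indicator 1 ω := by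
    intro ω
    by_cases h : SminusFn I ω = 0
    · rw [indicator_of_mem ((emn ω).1 h), indicator_of_mem (by exact h)]
      rfl
    · rw [indicator_of_notMem (fun h' => h ((emn ω).2 h')), indicator_of_notMem (by exact h)]
  -- almost surely the forward part is finite
  have hfin' : ∀ᵐ ω ∂P, SplusFn I ω ≠ ⊤ := by
    rw [ae_iff]
    have hle : P {ω | SplusFn I ω ≠ ⊤}ᶜ = 0 := by
      have hms : MeasurableSet {ω | SplusFn I ω ≠ ⊤} := by
        have : Measurable (fun ω => pathSize (fun t => decide (0 < t) && I t ω)) :=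
          pathSize_meas.comp (measurable_pi_lambda _ fun t =>
            (Measurable.of_discrete (f := fun b => decide (0 < t) && b)).comp (hI t))
        have e : {ω | SplusFn I ω ≠ ⊤} =
            ((fun ω => pathSize (fun t => decide (0 < t) && I t ω)) ⁻¹' {⊤})ᶜ := by
          ext ω
          have := pathSize_eq (fun t ω => decide (0 < t) && I t ω) ω
          simp only [mem_compl_iff, mem_preimage, ← this, mem_singleton_iff]
          simp [SiFn, SplusFn]
        rw [e]
        exact (this (measurableSet_singleton _)).compl
      exact (prob_compl_eq_zero_iff hms).2 hfin
    simpa [compl_def] using hle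
  have hSfin : ∀ᵐ ω ∂P, SiFn I ω ≠ ⊤ := by
    have hH : Measurable (fun v : ℝ≥0∞ => if v = ⊤ then (1 : ℝ≥0∞) else 0) :=
      Measurable.ite (measurableSet_singleton _) measurable_const measurable_const
    have key := aux_mtp P I hI htr _ hBp _ hH
    have e1 : ∫⁻ ω, (if (SiFn I ω : ℝ≥0∞) = ⊤ then (1 : ℝ≥0∞) else 0) *
        ∑' s, (if I s ω = true then {y : ℤ → Bool | ∀ t > 0, y t = false}.indicator 1
          (fun t => I (t + s) ω) else 0) ∂P
        = ∫⁻ ω, (if (SiFn I ω : ℝ≥0∞) = ⊤ then (1 : ℝ≥0∞) else 0) ∂P := by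
      refine lintegral_congr_ae ?_
      filter_upwards [h0, hfin'] with ω h1 h2
      rw [sum_max (fun t => I t ω) h1 (Set.encard_ne_top_iff.1 h2), mul_one]
    rw [e1] at key
    have hfinI : ∫⁻ ω, (if (SiFn I ω : ℝ≥0∞) = ⊤ then (1 : ℝ≥0∞) else 0) ∂P ≠ ⊤ := by
      refine ne_top_of_le_ne_top (b := 1) (by simp) ?_
      calc _ ≤ ∫⁻ ω, 1 ∂P := lintegral_mono fun ω => by split_ifs <;> simp
        _ = 1 := by simp
    have hz : ∫⁻ ω, (if (SiFn I ω : ℝ≥0∞) = ⊤ then (1 : ℝ≥0∞) else 0) *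
        ({y : ℤ → Bool | ∀ t > 0, y t = false}.indicator 1 (fun t => I t ω) * (SiFn I ω)) ∂P = 0 := by
      rw [key] at hfinI
      have hlt := ae_lt_top ((hH.comp mS).mul (mIp.mul mS)) hfinI
      refine (lintegral_eq_zero_iff ((hH.comp mS).mul (mIp.mul mS))).2 ?_
      filter_upwards [hlt] with ω hω
      simp only [Function.comp, Pi.mul_apply, Pi.zero_apply] at hω ⊢
      by_cases hs : (SiFn I ω : ℝ≥0∞) = ⊤
      · rw [if_pos hs, hs] at hω ⊢
        by_cases hb : (fun t => I t ω) ∈ {y : ℤ → Bool | ∀ t > 0, y t = false}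
        · rw [indicator_of_mem hb] at hω
          simp at hω
        · rw [indicator_of_notMem hb]; simp
      · rw [if_neg hs, zero_mul]
    rw [hz] at key
    have := (lintegral_eq_zero_iff (hH.comp mS)).1 key
    filter_upwards [this] with ω hω h
    simp [h] at hω
  have hsum : ∀ᵐ ω ∂P, ∑' s, (if I s ω = true then {y : ℤ → Bool | ∀ t < 0, y t = false}.indicator
      (1 : (ℤ → Bool) → ℝ≥0∞) (fun t => I (t + s) ω) else 0) = 1 := by
    filter_upwards [h0, hSfin] with ω h1 h2
    exact sum_min (fun t => I t ω) h1 (Set.encard_ne_top_iff.1 h2)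
  have hpos' : ∀ᵐ ω ∂P, ∃ k : ℕ, 1 ≤ k ∧ SiFn I ω = k := by
    filter_upwards [h0, hSfin] with ω h1 h2
    obtain ⟨k, hk⟩ := ENat.ne_top_iff_exists.1 h2
    refine ⟨k, ?_, hk.symm⟩
    by_contra hc
    have hk0 : k = 0 := by omega
    rw [hk0] at hk
    have : ({t : ℤ | I t ω = true}).encard = 0 := hk.symm
    rw [Set.encard_eq_zero] at this
    have h3 : (0 : ℤ) ∈ {t : ℤ | I t ω = true} := h1
    rw [this] at h3
    exact h3
  -- mass transport with the constant function one
  have hA : ∫⁻ ω, {ω | SminusFn I ω = 0}.indicator 1 ω * (SiFn I ω : ℝ≥0∞) ∂P = 1 := by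
    have key := aux_mtp P I hI htr _ hBm (fun _ => 1) measurable_const
    simp only [one_mul, hI'] at key
    rw [← key, lintegral_congr_ae hsum]
    simp
  -- mass transport with the reciprocal
  have hBB : ∫⁻ ω, (SiFn I ω : ℝ≥0∞)⁻¹ ∂P = P {ω | SminusFn I ω = 0} := by
    have key := aux_mtp P I hI htr _ hBm (fun v => v⁻¹) measurable_inv
    simp only [hI'] at key
    calc _ = _ := by
          refine lintegral_congr_ae ?_
          filter_upwards [hsum] with ω hω
          rw [hω, mul_one]
      _ = _ := key
      _ = ∫⁻ ω, {ω | SminusFn I ω = 0}.indicator 1 ω ∂P := by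
          refine lintegral_congr_ae ?_
          filter_upwards [hpos'] with ω hω
          obtain ⟨k, hk, hω⟩ := hω
          rw [hω, mul_left_comm, ENNReal.inv_mul_cancel, mul_one]
          · simp; omega
          · simp
      _ = _ := lintegral_indicator_one mm
  have hE : (∑' k : ℕ, (k : ℝ≥0∞) * (P ({ω | SiFn I ω = ((k : ℕ) : ℕ∞)} ∩ {ω | SminusFn I ω = 0}) / P {ω | SminusFn I ω = 0})) = (P {ω | SminusFn I ω = 0})⁻¹ := by
    have : (∑' k : ℕ, (k : ℝ≥0∞) * P ({ω | SiFn I ω = ((k : ℕ) : ℕ∞)} ∩ {ω | SminusFn I ω = 0})) = 1 := by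
      rw [← hA]
      calc _ = ∑' k : ℕ, ∫⁻ ω, (k : ℝ≥0∞) * ({ω | SiFn I ω = ((k : ℕ) : ℕ∞)} ∩ {ω | SminusFn I ω = 0}).indicator 1 ω ∂P := by
            refine tsum_congr fun k => ?_
            rw [lintegral_const_mul _ (measurable_one.indicator ((mk _).inter mm)),
              lintegral_indicator_one ((mk _).inter mm)]
        _ = ∫⁻ ω, ∑' k : ℕ, (k : ℝ≥0∞) * ({ω | SiFn I ω = ((k : ℕ) : ℕ∞)} ∩ {ω | SminusFn I ω = 0}).indicator 1 ω ∂P := by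
            rw [lintegral_tsum]
            exact fun k => ((measurable_one.indicator ((mk _).inter mm)).const_mul _).aemeasurable
        _ = _ := by
            refine lintegral_congr_ae ?_
            filter_upwards [hpos'] with ω hω
            obtain ⟨k, hk, hω⟩ := hω
            rw [tsum_eq_single k]
            · by_cases h : SminusFn I ω = 0 <;> simp [indicator, hω, h]
            · intro j hj
              have : ¬ (k = j) := fun h => hj h.symm
              simp [indicator, hω, this]
    simp only [div_eq_mul_inv, ← mul_assoc]
    rw [ENNReal.tsum_mul_right, this, one_mul]
  rw [hE] at heq
  have hθ0 : P {ω | SminusFn I ω = 0} ≠ 0 := by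
    rw [← hBB]
    intro h
    replace h := (lintegral_eq_zero_iff mSi).1 h
    have hF : ∀ᵐ ω ∂P, False := by
      filter_upwards [h, hSfin] with ω h1 h2
      simp at h1
      exact h2 h1
    exact hF.exists.elim (fun _ h => h)
  set θ := P {ω | SminusFn I ω = 0} with hθdef
  have hθt : θ ≠ ⊤ := measure_ne_top _ _
  set m : ℝ := θ.toReal⁻¹ with hm
  have hθr : 0 < θ.toReal := ENNReal.toReal_pos hθ0 hθt
  have hm0 : 0 < m := by positivity
  have hθm : θ⁻¹ = ENNReal.ofReal m := by
    rw [hm, ENNReal.ofReal_inv_of_pos hθr, ENNReal.ofReal_toReal hθt]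
  have hθm' : θ = ENNReal.ofReal m⁻¹ := by
    rw [hm, inv_inv, ENNReal.ofReal_toReal hθt]
  have hae := ae_eq_of_ae_le_of_lintegral_le (μ := P) (f := fun _ => ENNReal.ofReal (2 * m))
    (g := fun ω => (SiFn I ω : ℝ≥0∞) + ENNReal.ofReal (m ^ 2) * (SiFn I ω : ℝ≥0∞)⁻¹)
    (by
      filter_upwards [hpos'] with ω hω
      obtain ⟨k, hk, hω⟩ := hω
      simpa [hω] using (jensen_pt k hk m hm0).1)
    (by rw [lintegral_const, measure_univ, mul_one]; exact ENNReal.ofReal_ne_top)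
    (mS.add (mSi.const_mul _)).aemeasurable
    (by
      rw [lintegral_add_left mS, lintegral_const_mul _ mSi, hBB, ← heq, hθm, hθm',
        ← ENNReal.ofReal_mul (by positivity), ← ENNReal.ofReal_add (by positivity) (by positivity)]
      simp only [lintegral_const, measure_univ, mul_one]
      apply le_of_eq
      congr 1
      field_simp
      ring)
  have hfinal : ∀ᵐ ω ∂P, ∃ k : ℕ, 1 ≤ k ∧ SiFn I ω = k ∧ (k : ℝ) = m := by
    filter_upwards [hae, hpos'] with ω h1 hω
    obtain ⟨k, hk, hω⟩ := hω
    refine ⟨k, hk, hω, (jensen_pt k hk m hm0).2 ?_⟩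
    simpa [hω] using h1
  obtain ⟨ω0, k, hk, -, hkm⟩ := hfinal.exists
  refine ⟨k, hk, ?_⟩
  rw [← mem_ae_iff_prob_eq_one (mk _)]
  filter_upwards [hfinal] with ω hω
  obtain ⟨j, hj, h1, h2⟩ := hω
  have : j = k := by exact_mod_cast h2.trans hkm.symm
  rw [h1, this]
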